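/- arXiv:2407.11545 — 3 statements merged into one kernel-verified Lean document; each statement's English description precedes it below -/
import Mathlib

section
/- Non-committal simulation of seeded Tile Automata systems is transitive: if Γ_1 non-committally simulates Γ_2 under representation function R_1 and Γ_2 non-committally simulates Γ_3 under representation function R_2, then Γ_1 non-committally simulates Γ_3 under the composed representation function; in particular the equivalent-productions condition (for some fuzz bound c), the follows condition, and the non-committally-models condition are all preserved under composition of representation functions. -/
open scoped Classical

/-- Positions in the plane. -/
abbrev Pos : Type := ℤ × ℤ

/-- An assembly: a finite partial placement of states (encoded as naturals) on `ℤ²`. -/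
structure Assembly where
  tiles : Pos → Option ℕ
  finite : {p : Pos | tiles p ≠ none}.Finite

/-- A transition rule `((σ1, σ2), (σ3, σ4), d)`; `d = true` is horizontal
(first state west), `d = false` is vertical (first state north). -/
abbrev Rule : Type := (ℕ × ℕ) × (ℕ × ℕ) × Bool

/-- The neighbour of `p` in orientation `d` (east for horizontal, south for vertical). -/
def nbr (p : Pos) (d : Bool) : Pos := if d then (p.1 + 1, p.2) else (p.1, p.2 - 1)

/-- The bond strength contributed by the ordered pair of positions `p`, `q` in `A`. -/
def bond (aff : ℕ → ℕ → Bool → ℕ) (A : Assembly) (p q : Pos) : ℕ :=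
  match A.tiles p, A.tiles q with
  | some σ1, some σ2 =>
      (if q = nbr p true then aff σ1 σ2 true else 0) +
      (if q = nbr p false then aff σ1 σ2 false else 0)
  | _, _ => 0

/-- The total weight of the cut `S` in the bond graph of `A`. -/
noncomputable def cutWeight (aff : ℕ → ℕ → Bool → ℕ) (A : Assembly) (S : Set Pos) : ℕ :=
  ∑ p ∈ A.finite.toFinset, ∑ q ∈ A.finite.toFinset,
    if p ∈ S ∧ q ∉ S then bond aff A p q + bond aff A q p else 0

/-- `A` is `τ`-stable: every cut separating the tiles of `A` has weight at least `τ`. -/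
def StableAt (aff : ℕ → ℕ → Bool → ℕ) (τ : ℕ) (A : Assembly) : Prop :=
  ∀ S : Set Pos,
    (∃ p, A.tiles p ≠ none ∧ p ∈ S) → (∃ p, A.tiles p ≠ none ∧ p ∉ S) →
    τ ≤ cutWeight aff A S

/-- A transition rule is affinity strengthening: it maintains or increases the
affinity of the transitioning pair and of every other potential neighbour. -/
def Strengthening (aff : ℕ → ℕ → Bool → ℕ) (r : Rule) : Prop :=
  aff r.1.1 r.1.2 r.2.2 ≤ aff r.2.1.1 r.2.1.2 r.2.2 ∧
  ∀ (σ : ℕ) (d : Bool),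
    aff r.1.1 σ d ≤ aff r.2.1.1 σ d ∧ aff σ r.1.1 d ≤ aff σ r.2.1.1 d ∧
    aff r.1.2 σ d ≤ aff r.2.1.2 σ d ∧ aff σ r.1.2 d ≤ aff σ r.2.1.2 d

/-- A seeded Tile Automata system `(Σ, Λ, Π, Δ, s, τ)`. -/
structure TASystem where
  states : Finset ℕ
  initial : Finset ℕ
  aff : ℕ → ℕ → Bool → ℕ
  rules : Finset Rule
  seed : Assembly
  temp : ℕ
  temp_pos : 0 < temp
  initial_sub : initial ⊆ states
  seed_states : ∀ p σ, seed.tiles p = some σ → σ ∈ states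
  seed_stable : StableAt aff temp seed
  rules_strengthening : ∀ r ∈ rules, Strengthening aff r
  rules_states : ∀ r ∈ rules,
    r.1.1 ∈ states ∧ r.1.2 ∈ states ∧ r.2.1.1 ∈ states ∧ r.2.1.2 ∈ states

/-- A single-tile attachment step. -/
def AttachStep (Γ : TASystem) (A B : Assembly) : Prop :=
  ∃ (p : Pos) (σ : ℕ), σ ∈ Γ.initial ∧ A.tiles p = none ∧
    B.tiles = Function.update A.tiles p (some σ) ∧
    StableAt Γ.aff Γ.temp B

/-- A pairwise transition step. -/
def TransStep (Γ : TASystem) (A B : Assembly) : Prop :=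
  ∃ r ∈ Γ.rules, ∃ p : Pos,
    A.tiles p = some r.1.1 ∧ A.tiles (nbr p r.2.2) = some r.1.2 ∧
    B.tiles = Function.update (Function.update A.tiles p (some r.2.1.1))
      (nbr p r.2.2) (some r.2.1.2)

/-- A single production step `A →^Γ_1 B`. -/
def Step (Γ : TASystem) (A B : Assembly) : Prop := AttachStep Γ A B ∨ TransStep Γ A B

/-- `A →^Γ B`: reflexive-transitive closure of single steps. -/
def Reach (Γ : TASystem) : Assembly → Assembly → Prop := Relation.ReflTransGen (Step Γ)

/-- The producible assemblies of `Γ`. -/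
def Producible (Γ : TASystem) (A : Assembly) : Prop := Reach Γ Γ.seed A

/-- `m`-blocks over (ℕ-encoded) states. -/
abbrev Block (m : ℕ) : Type := Fin m × Fin m → Option ℕ

def emptyBlock (m : ℕ) : Block m := fun _ => none

/-- A valid `m`-block representation function maps the empty block to empty. -/
def RepFun (m : ℕ) (R : Block m → Option ℕ) : Prop :=
  0 < m ∧ R (emptyBlock m) = none

/-- The `m`-block of `A` with block coordinates `(x, y)`. -/
def blockAt (m : ℕ) (A : Assembly) (x y : ℤ) : Block m :=
  fun ij => A.tiles ((m : ℤ) * x + (ij.1.1 : ℤ), (m : ℤ) * y + (ij.2.1 : ℤ))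

/-- `B = R*(A)`: the blockwise image of `A` under `R`. -/
def RepMap (m : ℕ) (R : Block m → Option ℕ) (A B : Assembly) : Prop :=
  ∀ x y : ℤ, B.tiles (x, y) = R (blockAt m A x y)

/-- Condition 1 of equivalent productions: `{R*(A') : A' ∈ PROD_{Γ_S}} = PROD_{Γ_T}`. -/
def EquivProdSet (m : ℕ) (R : Block m → Option ℕ) (ΓS ΓT : TASystem) : Prop :=
  (∀ A', Producible ΓS A' → ∃ A, Producible ΓT A ∧ RepMap m R A' A) ∧
  (∀ A, Producible ΓT A → ∃ A', Producible ΓS A' ∧ RepMap m R A' A)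

/-- `Γ_S` achieves `c`-fuzz under `R*`. -/
def AchievesFuzz (m : ℕ) (R : Block m → Option ℕ) (ΓS : TASystem) (c : ℕ) : Prop :=
  ∀ A', Producible ΓS A' → ∀ x y : ℤ,
    blockAt m A' x y ≠ emptyBlock m → R (blockAt m A' x y) = none →
    ∃ u v : ℤ, |u| ≤ (c : ℤ) ∧ |v| ≤ (c : ℤ) ∧ R (blockAt m A' (x + u) (y + v)) ≠ none

/-- `Γ_T` follows `Γ_S` under `R`. -/
def Follows (m : ℕ) (R : Block m → Option ℕ) (ΓS ΓT : TASystem) : Prop :=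
  ∀ A' B', Producible ΓS A' → Reach ΓS A' B' →
    ∀ A B, RepMap m R A' A → RepMap m R B' B → Reach ΓT A B

/-- `Γ_S` non-committally models `Γ_T` under `R`. -/
def Models (m : ℕ) (R : Block m → Option ℕ) (ΓS ΓT : TASystem) : Prop :=
  ∀ A B, Producible ΓT A → Reach ΓT A B →
    ∀ A', Producible ΓS A' → RepMap m R A' A →
      ∃ B', Reach ΓS A' B' ∧ RepMap m R B' B

/-- `Γ_S` non-committally simulates `Γ_T` under `R` with fuzz bound `c`. -/
def SimulatesFuzz (m : ℕ) (R : Block m → Option ℕ) (ΓS ΓT : TASystem) (c : ℕ) : Prop :=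
  RepFun m R ∧ EquivProdSet m R ΓS ΓT ∧ AchievesFuzz m R ΓS c ∧
  Follows m R ΓS ΓT ∧ Models m R ΓS ΓT

/-- `Γ_S` non-committally simulates `Γ_T` under `R` (with some fuzz bound). -/
def Simulates (m : ℕ) (R : Block m → Option ℕ) (ΓS ΓT : TASystem) : Prop :=
  ∃ c : ℕ, 0 < c ∧ SimulatesFuzz m R ΓS ΓT c

/-- Index arithmetic for composing block representation functions. -/
theorem compose_idx_lt {m1 m2 : ℕ} (i : Fin m2) (a : Fin m1) :
    i.1 * m1 + a.1 < m1 * m2 := by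
  have h1 := a.isLt
  have h2 := i.isLt
  have h3 : i.1 * m1 + a.1 < (i.1 + 1) * m1 := by
    rw [add_mul, one_mul]
    omega
  have h4 : (i.1 + 1) * m1 ≤ m2 * m1 := Nat.mul_le_mul_right m1 h2
  rw [Nat.mul_comm m1 m2]
  omega

/-- Composition of an `m1`-block representation function (from the innermost
simulator) with an `m2`-block representation function, yielding an
`(m1·m2)`-block representation function. -/
def composeRep (m1 m2 : ℕ) (R1 : Block m1 → Option ℕ) (R2 : Block m2 → Option ℕ) :
    Block (m1 * m2) → Option ℕ := fun B =>
  R2 (fun pq => R1 (fun ab =>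
    B (⟨pq.1.1 * m1 + ab.1.1, compose_idx_lt pq.1 ab.1⟩,
       ⟨pq.2.1 * m1 + ab.2.1, compose_idx_lt pq.2 ab.2⟩)))

theorem composeRep_eq {m1 m2 : ℕ} {R1 : Block m1 → Option ℕ} {R2 : Block m2 → Option ℕ}
    {A B : Assembly} (h : RepMap m1 R1 A B) (x y : ℤ) :
    composeRep m1 m2 R1 R2 (blockAt (m1 * m2) A x y) = R2 (blockAt m2 B x y) := by
  unfold composeRep
  congr 1
  funext pq
  simp only [blockAt]
  rw [h]
  congr 1
  funext ab
  simp only [blockAt]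
  congr 2 <;> push_cast <;> ring

theorem div_bound {m c : ℕ} (x u i : ℤ) (hi : 0 ≤ i) (him : i < m) (hu : |u| ≤ (c : ℤ)) :
    |((m : ℤ) * x + i + u) / (m : ℤ) - x| ≤ (c : ℤ) := by
  have hm : (0 : ℤ) < m := by omega
  have hc : (0 : ℤ) ≤ c := by positivity
  obtain ⟨h1, h2⟩ := abs_le.mp hu
  rw [abs_le]
  constructor
  · have : x - c ≤ ((m : ℤ) * x + i + u) / (m : ℤ) := by
      rw [Int.le_ediv_iff_mul_le hm]
      nlinarith
    linarith
  · have : ((m : ℤ) * x + i + u) / (m : ℤ) < x + c + 1 := by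
      rw [Int.ediv_lt_iff_lt_mul hm]
      nlinarith
    linarith

theorem exists_tile_of_block {m : ℕ} {A : Assembly} {x y : ℤ}
    (h : blockAt m A x y ≠ emptyBlock m) : ∃ i j : Fin m,
      A.tiles ((m : ℤ) * x + (i.1 : ℤ), (m : ℤ) * y + (j.1 : ℤ)) ≠ none := by
  by_contra hc
  push Not at hc
  exact h (funext fun ij => hc ij.1 ij.2)

theorem block_ne_of_tile {m : ℕ} (hm : 0 < m) {A : Assembly} {X Y : ℤ}
    (h : A.tiles (X, Y) ≠ none) :
    blockAt m A (X / m) (Y / m) ≠ emptyBlock m := by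
  intro he
  apply h
  have hm' : (0 : ℤ) < m := by exact_mod_cast hm
  have hX0 := Int.emod_nonneg X hm'.ne'
  have hX1 := Int.emod_lt_of_pos X hm'
  have hY0 := Int.emod_nonneg Y hm'.ne'
  have hY1 := Int.emod_lt_of_pos Y hm'
  have := congrFun he (⟨(X % m).toNat, by omega⟩, ⟨(Y % m).toNat, by omega⟩)
  simp only [blockAt, emptyBlock, Int.toNat_of_nonneg hX0, Int.toNat_of_nonneg hY0,
    Int.mul_ediv_add_emod] at this
  exact this

/-- Fuzz is preserved under composition. -/
theorem fuzz_trans {Γ1 Γ2 : TASystem} {m1 m2 : ℕ}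
    {R1 : Block m1 → Option ℕ} {R2 : Block m2 → Option ℕ} {c1 c2 : ℕ}
    (hm1 : RepFun m1 R1) (hm2 : RepFun m2 R2)
    (hE : EquivProdSet m1 R1 Γ1 Γ2)
    (hF1 : AchievesFuzz m1 R1 Γ1 c1) (hF2 : AchievesFuzz m2 R2 Γ2 c2) :
    AchievesFuzz (m1 * m2) (composeRep m1 m2 R1 R2) Γ1 (c1 + c2) := by
  intro A hA x y hne _
  obtain ⟨B, hB, hAB⟩ := hE.1 A hA
  simp only [composeRep_eq hAB]
  have hp1 : (0 : ℤ) < m1 := by exact_mod_cast hm1.1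
  obtain ⟨i, j, hij⟩ := exists_tile_of_block hne
  have hblk := block_ne_of_tile hm1.1 hij
  have key : ∀ (x : ℤ) (i : Fin (m1 * m2)),
      (((m1 * m2 : ℕ) : ℤ) * x + (i.1 : ℤ)) / (m1 : ℤ) = m2 * x + (i.1 : ℤ) / (m1 : ℤ) := by
    intro x i
    rw [show ((m1 * m2 : ℕ) : ℤ) * x + (i.1 : ℤ) = (i.1 : ℤ) + m1 * (m2 * x) by push_cast; ring,
      Int.add_mul_ediv_left _ _ hp1.ne']
    ring
  have kb : ∀ i : Fin (m1 * m2), 0 ≤ (i.1 : ℤ) / (m1 : ℤ) ∧ (i.1 : ℤ) / (m1 : ℤ) < m2 := by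
    intro i
    refine ⟨Int.ediv_nonneg (by positivity) hp1.le, ?_⟩
    rw [Int.ediv_lt_iff_lt_mul hp1]
    have h := i.2
    have h' : (i.1 : ℤ) < ((m1 * m2 : ℕ) : ℤ) := by exact_mod_cast h
    push_cast at h'
    linarith [mul_comm (m1 : ℤ) m2]
  rw [key, key] at hblk
  obtain ⟨u, v, hu, hv, huv⟩ : ∃ u v : ℤ, |u| ≤ (c1 : ℤ) ∧ |v| ≤ (c1 : ℤ) ∧
      B.tiles (m2 * x + (i.1 : ℤ) / (m1 : ℤ) + u, m2 * y + (j.1 : ℤ) / (m1 : ℤ) + v) ≠ none := by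
    by_cases hR : R1 (blockAt m1 A (m2 * x + (i.1 : ℤ) / (m1 : ℤ))
        (m2 * y + (j.1 : ℤ) / (m1 : ℤ))) = none
    · obtain ⟨u, v, hu, hv, huv⟩ := hF1 A hA _ _ hblk hR
      exact ⟨u, v, hu, hv, by rw [hAB]; exact huv⟩
    · exact ⟨0, 0, by simp, by simp, by rw [hAB]; simpa using hR⟩
  have hblk2 := block_ne_of_tile hm2.1 huv
  have bx := div_bound x u _ (kb i).1 (kb i).2 hu
  have bz := div_bound y v _ (kb j).1 (kb j).2 hv
  generalize ((m2 : ℤ) * x + (i.1 : ℤ) / (m1 : ℤ) + u) / (m2 : ℤ) = X at *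
  generalize ((m2 : ℤ) * y + (j.1 : ℤ) / (m1 : ℤ) + v) / (m2 : ℤ) = Y at *
  have hc2 : (0 : ℤ) ≤ c2 := by positivity
  push_cast
  by_cases hR : R2 (blockAt m2 B X Y) = none
  · obtain ⟨s, t, hs, ht, hst⟩ := hF2 B hB _ _ hblk2 hR
    refine ⟨X - x + s, Y - y + t, (abs_add_le _ _).trans (by linarith),
      (abs_add_le _ _).trans (by linarith), ?_⟩
    rw [show x + (X - x + s) = X + s by ring, show y + (Y - y + t) = Y + t by ring]
    exact hst
  · refine ⟨X - x, Y - y, by linarith, by linarith, ?_⟩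
    rw [show x + (X - x) = X by ring, show y + (Y - y) = Y by ring]
    exact hR

/-- Non-committal simulation is transitive: if `Γ1` non-committally
simulates `Γ2` under `R1` and `Γ2` non-committally simulates `Γ3` under `R2`, then
`Γ1` non-committally simulates `Γ3` under the composed representation function
(in particular equivalent productions for some fuzz bound, follows, and
non-committally-models are all preserved). -/
theorem simulationTransitive
    (Γ1 Γ2 Γ3 : TASystem) (m1 m2 : ℕ)
    (R1 : Block m1 → Option ℕ) (R2 : Block m2 → Option ℕ)
    (h12 : Simulates m1 R1 Γ1 Γ2) (h23 : Simulates m2 R2 Γ2 Γ3) :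
    Simulates (m1 * m2) (composeRep m1 m2 R1 R2) Γ1 Γ3 := by
  obtain ⟨c1, hc1, hr1, hE1, hF1, hfo1, hmo1⟩ := h12
  obtain ⟨c2, hc2, hr2, hE2, hF2, hfo2, hmo2⟩ := h23
  refine ⟨c1 + c2, by omega, ⟨Nat.mul_pos hr1.1 hr2.1, ?_⟩, ⟨?_, ?_⟩,
    fuzz_trans hr1 hr2 hE1 hF1 hF2, ?_, ?_⟩
  · have h1 : R1 (fun _ => none) = none := hr1.2
    have h2 : R2 (fun _ => none) = none := hr2.2
    simp only [composeRep, emptyBlock, h1, h2]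
  · intro A hA
    obtain ⟨B, hB, hAB⟩ := hE1.1 A hA
    obtain ⟨C, hC, hBC⟩ := hE2.1 B hB
    exact ⟨C, hC, fun x y => by rw [composeRep_eq hAB]; exact hBC x y⟩
  · intro C hC
    obtain ⟨B, hB, hBC⟩ := hE2.2 C hC
    obtain ⟨A, hA, hAB⟩ := hE1.2 B hB
    exact ⟨A, hA, fun x y => by rw [composeRep_eq hAB]; exact hBC x y⟩
  · intro A A' hA hAA' C C' hAC hAC'
    obtain ⟨B, hB, hAB⟩ := hE1.1 A hA
    obtain ⟨B', hB', hAB'⟩ := hE1.1 A' (Relation.ReflTransGen.trans hA hAA')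
    exact hfo2 B B' hB (hfo1 A A' hA hAA' B B' hAB hAB') C C'
      (fun x y => (hAC x y).trans (composeRep_eq hAB x y))
      (fun x y => (hAC' x y).trans (composeRep_eq hAB' x y))
  · intro C C' hC hCC' A hA hAC
    obtain ⟨B, hB, hAB⟩ := hE1.1 A hA
    obtain ⟨B', hBB', hBC'⟩ := hmo2 C C' hC hCC' B hB
      (fun x y => (hAC x y).trans (composeRep_eq hAB x y))
    obtain ⟨A', hAA', hAB'⟩ := hmo1 B B' hB hBB' A hA hAB
    exact ⟨A', hAA', fun x y => by rw [composeRep_eq hAB']; exact hBC' x y⟩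
end

section
/- If Γ_0, Γ_1, ..., Γ_k is a chain of seeded Tile Automata systems in which each Γ_i non-committally simulates Γ_{i+1} with 1-fuzz and with block scale factor at least 2, then the composed simulation of Γ_k by Γ_0 achieves at most 3-fuzz. -/
open scoped Classical

/-- The scale of a chain of `k` simulations with scale factors `m 0, …, m (k-1)`. -/
def chainScale : ℕ → (ℕ → ℕ) → ℕ
  | 0, _ => 1
  | k + 1, m => m 0 * chainScale k (fun i => m (i + 1))

/-- The composed representation function of a chain of `k` simulations with scales
`m i` and representation functions `R i`. -/
def chainRep : (k : ℕ) → (m : ℕ → ℕ) → (∀ i : ℕ, Block (m i) → Option ℕ) →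
    Block (chainScale k m) → Option ℕ
  | 0, _, _ => fun B => B (⟨0, Nat.one_pos⟩, ⟨0, Nat.one_pos⟩)
  | k + 1, m, R =>
      composeRep (m 0) (chainScale k (fun i => m (i + 1))) (R 0)
        (chainRep k (fun i => m (i + 1)) (fun i => R (i + 1)))

theorem compose_block {m1 m2 : ℕ} {R1 : Block m1 → Option ℕ} (R2 : Block m2 → Option ℕ)
    {A A1 : Assembly} (h : RepMap m1 R1 A A1) (x y : ℤ) :
    composeRep m1 m2 R1 R2 (blockAt (m1 * m2) A x y) = R2 (blockAt m2 A1 x y) := by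
  unfold composeRep
  congr 1
  funext pq
  have := h ((m2 : ℤ) * x + (pq.1.1 : ℤ)) ((m2 : ℤ) * y + (pq.2.1 : ℤ))
  simp only [blockAt] at this ⊢
  rw [this]
  congr 1
  funext ab
  congr 2
  · push_cast; ring
  · push_cast; ring

theorem compose_repMap {m1 m2 : ℕ} {R1 : Block m1 → Option ℕ} {R2 : Block m2 → Option ℕ}
    {A A1 B : Assembly} (h : RepMap m1 R1 A A1) :
    RepMap (m1 * m2) (composeRep m1 m2 R1 R2) A B ↔ RepMap m2 R2 A1 B := by
  unfold RepMap
  simp only [compose_block R2 h]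

/-- Strong fuzz invariant. -/
def TileFuzz (m : ℕ) (R : Block m → Option ℕ) (ΓS : TASystem) : Prop :=
  ∀ A, Producible ΓS A → ∀ a b x y : ℤ, A.tiles (a, b) ≠ none →
    |x - a| ≤ 2 → |y - b| ≤ 2 →
    ∃ u v : ℤ, |u| ≤ 2 ∧ |v| ≤ 2 ∧ R (blockAt m A (x / m + u) (y / m + v)) ≠ none

theorem div_close {m : ℕ} (hm : 2 ≤ m) {a x : ℤ} (h : |x - a| ≤ 2) :
    |x / (m : ℤ) - a / (m : ℤ)| ≤ 1 := by
  have hm' : (2 : ℤ) ≤ m := by exact_mod_cast hm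
  have hp : (0 : ℤ) < m := by linarith
  rw [abs_le] at h ⊢
  have e : ∀ z : ℤ, (z + m) / (m : ℤ) = z / m + 1 := fun z =>
    Int.add_ediv_of_dvd_right (dvd_refl _) |>.trans (by rw [Int.ediv_self hp.ne'])
  have h1 : x / (m : ℤ) ≤ (a + m) / m := Int.ediv_le_ediv hp (by linarith)
  have h2 : a / (m : ℤ) ≤ (x + m) / m := Int.ediv_le_ediv hp (by linarith)
  rw [e] at h1 h2
  constructor <;> linarith

theorem block_ne {m : ℕ} (hm : 0 < m) {A : Assembly} {a b : ℤ} (h : A.tiles (a, b) ≠ none) :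
    blockAt m A (a / m) (b / m) ≠ emptyBlock m := by
  intro he
  have hp : (0 : ℤ) < m := by exact_mod_cast hm
  have key : ∀ z : ℤ, ∃ i : Fin m, (m : ℤ) * (z / m) + (i.1 : ℤ) = z := by
    intro z
    have h0 := Int.emod_nonneg z hp.ne'
    have h1 := Int.emod_lt_of_pos z hp
    refine ⟨⟨(z % m).toNat, by omega⟩, ?_⟩
    have := Int.mul_ediv_add_emod z m
    simp only [Int.toNat_of_nonneg h0]
    exact this
  obtain ⟨i, hi⟩ := key a
  obtain ⟨j, hj⟩ := key b
  have := congrFun he (i, j)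
  simp only [blockAt, emptyBlock, hi, hj] at this
  exact h this

theorem tileFuzz_step {m1 m2 : ℕ} {R1 : Block m1 → Option ℕ} {R2 : Block m2 → Option ℕ}
    {Γ0 Γ1 : TASystem} (hm : 2 ≤ m1) (h : SimulatesFuzz m1 R1 Γ0 Γ1 1)
    (h2 : TileFuzz m2 R2 Γ1) : TileFuzz (m1 * m2) (composeRep m1 m2 R1 R2) Γ0 := by
  obtain ⟨-, hE, hF, -, -⟩ := h
  intro A hA a b x y hab hx hy
  obtain ⟨A1, hA1, hr⟩ := hE.1 A hA
  have hne := block_ne (m := m1) (by omega) hab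
  obtain ⟨u, v, hu, hv, huv⟩ : ∃ u v : ℤ, |u| ≤ 1 ∧ |v| ≤ 1 ∧
      R1 (blockAt m1 A (a / m1 + u) (b / m1 + v)) ≠ none := by
    by_cases hc : R1 (blockAt m1 A (a / m1) (b / m1)) = none
    · simpa using hF A hA _ _ hne hc
    · exact ⟨0, 0, by simp, by simp, by simpa using hc⟩
  rw [← hr] at huv
  have dx := div_close hm hx
  have dy := div_close hm hy
  obtain ⟨u', v', hu', hv', hf⟩ := h2 A1 hA1 _ _ (x / m1) (y / m1) huv
    (by rw [abs_le] at *; constructor <;> linarith)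
    (by rw [abs_le] at *; constructor <;> linarith)
  refine ⟨u', v', hu', hv', ?_⟩
  rw [compose_block R2 hr]
  have e : ∀ z : ℤ, z / ((m1 * m2 : ℕ) : ℤ) = z / m1 / m2 := fun z => by
    rw [Int.ediv_ediv_of_nonneg (by positivity)]; push_cast; rfl
  rw [e, e]
  exact hf

theorem chain_core (k : ℕ) : ∀ (Γ : ℕ → TASystem) (m : ℕ → ℕ)
    (R : ∀ i : ℕ, Block (m i) → Option ℕ)
    (_ : ∀ i < k, 2 ≤ m i)
    (_ : ∀ i < k, SimulatesFuzz (m i) (R i) (Γ i) (Γ (i + 1)) 1),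
    RepFun (chainScale k m) (chainRep k m R) ∧
    EquivProdSet (chainScale k m) (chainRep k m R) (Γ 0) (Γ k) ∧
    TileFuzz (chainScale k m) (chainRep k m R) (Γ 0) ∧
    Follows (chainScale k m) (chainRep k m R) (Γ 0) (Γ k) ∧
    Models (chainScale k m) (chainRep k m R) (Γ 0) (Γ k) := by
  induction k with
  | zero =>
    intro Γ m R _ _
    have hb : ∀ (A : Assembly) (x y : ℤ),
        chainRep 0 m R (blockAt (chainScale 0 m) A x y) = A.tiles (x, y) := by
      intro A x y
      simp [chainRep, blockAt, chainScale]
    have hr : ∀ A B : Assembly, RepMap (chainScale 0 m) (chainRep 0 m R) A B ↔ B = A := by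
      intro A B
      constructor
      · intro h
        have ht : B.tiles = A.tiles := by
          funext ⟨x, y⟩
          rw [h x y, hb]
        cases A; cases B; cases ht; rfl
      · rintro rfl x y
        rw [hb]
    refine ⟨⟨Nat.one_pos, rfl⟩, ⟨fun A h => ⟨A, h, (hr _ _).2 rfl⟩,
      fun A h => ⟨A, h, (hr _ _).2 rfl⟩⟩, ?_, ?_, ?_⟩
    · intro A hA a b x y hab hx hy
      refine ⟨a - x, b - y, by rwa [abs_sub_comm], by rwa [abs_sub_comm], ?_⟩
      rw [hb]
      simpa [chainScale] using hab
    · intro A' B' _ h A B h1 h2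
      rw [hr] at h1 h2
      subst h1 h2
      exact h
    · intro A B _ h A' _ h1
      rw [hr] at h1
      subst h1
      exact ⟨B, h, (hr _ _).2 rfl⟩
  | succ k ih =>
    intro Γ m R hs hsim
    obtain ⟨i1, i2, i3, i4, i5⟩ := ih (fun i => Γ (i + 1)) (fun i => m (i + 1))
      (fun i => R (i + 1)) (fun i hi => hs (i + 1) (by omega))
      (fun i hi => hsim (i + 1) (by omega))
    have h0 := hsim 0 (by omega)
    have hm := hs 0 (by omega)
    have h3 := tileFuzz_step hm h0 i3
    obtain ⟨j1, j2, -, j4, j5⟩ := h0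
    refine ⟨⟨Nat.mul_pos j1.1 i1.1, ?_⟩, ⟨?_, ?_⟩, h3, ?_, ?_⟩
    · have e1 := i1.2
      have e2 := j1.2
      unfold emptyBlock at e1 e2
      simp only [chainRep, composeRep, emptyBlock]
      rw [e2]
      exact e1
    · intro A' hA'
      obtain ⟨A1, hA1, r1⟩ := j2.1 A' hA'
      obtain ⟨A, hA, r2⟩ := i2.1 A1 hA1
      exact ⟨A, hA, (compose_repMap r1).2 r2⟩
    · intro A hA
      obtain ⟨A1, hA1, r2⟩ := i2.2 A hA
      obtain ⟨A', hA', r1⟩ := j2.2 A1 hA1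
      exact ⟨A', hA', (compose_repMap r1).2 r2⟩
    · intro A' B' hA' hr A B hA hB
      obtain ⟨A1, hA1, r1⟩ := j2.1 A' hA'
      obtain ⟨B1, hB1, r2⟩ := j2.1 B' (Relation.ReflTransGen.trans hA' hr)
      exact i4 A1 B1 hA1 (j4 A' B' hA' hr A1 B1 r1 r2) A B
        ((compose_repMap r1).1 hA) ((compose_repMap r2).1 hB)
    · intro A B hA hr A' hA' hAA
      obtain ⟨A1, hA1, r1⟩ := j2.1 A' hA'
      obtain ⟨B1, hB1, r2⟩ := i5 A B hA hr A1 hA1 ((compose_repMap r1).1 hAA)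
      obtain ⟨B', hB', r3⟩ := j5 A1 B1 hA1 hB1 A' hA' r1
      exact ⟨B', hB', (compose_repMap r3).2 r2⟩

/-- If `Γ 0, Γ 1, …, Γ k` is a chain of seeded Tile Automata systems
in which each `Γ i` non-committally simulates `Γ (i+1)` with 1-fuzz and block scale
factor at least 2, then the composed simulation of `Γ k` by `Γ 0` is a non-committal
simulation achieving at most 3-fuzz. -/
theorem chainFuzzThree
    (k : ℕ) (Γ : ℕ → TASystem) (m : ℕ → ℕ)
    (R : ∀ i : ℕ, Block (m i) → Option ℕ)
    (hscale : ∀ i < k, 2 ≤ m i)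
    (hsim : ∀ i < k, SimulatesFuzz (m i) (R i) (Γ i) (Γ (i + 1)) 1) :
    SimulatesFuzz (chainScale k m) (chainRep k m R) (Γ 0) (Γ k) 3 := by
  obtain ⟨h1, h2, h3, h4, h5⟩ := chain_core k Γ m R hscale hsim
  refine ⟨h1, h2, ?_, h4, h5⟩
  intro A hA x y hne _
  have hM : (0 : ℤ) < (chainScale k m : ℤ) := by exact_mod_cast h1.1
  obtain ⟨⟨i, j⟩, hij⟩ := Function.ne_iff.1 hne
  simp only [blockAt, emptyBlock] at hij
  obtain ⟨u, v, hu, hv, h⟩ := h3 A hA _ _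
    ((chainScale k m : ℤ) * x + (i.1 : ℤ)) ((chainScale k m : ℤ) * y + (j.1 : ℤ)) hij
    (by simp) (by simp)
  have e : ∀ (z : ℤ) (i : Fin (chainScale k m)),
      ((chainScale k m : ℤ) * z + (i.1 : ℤ)) / (chainScale k m : ℤ) = z := by
    intro z i
    rw [Int.mul_add_ediv_left _ _ hM.ne', Int.ediv_eq_zero_of_lt (by positivity)
      (by exact_mod_cast i.2), add_zero]
  rw [e, e] at h
  exact ⟨u, v, by push_cast; linarith, by push_cast; linarith, h⟩
end

section
/- The pairwise asynchronous cellular automaton model (2D ACA with cardinal-direction neighborhood of size 2 and radius 1, in which each rule updates a single cell based on that cell and one cardinally adjacent cell) is strongly (non-committally) intrinsically universal: there exists a fixed pairwise ACA rule set of constant size such that every pairwise ACA system (Σ, S, Δ, C) is non-committally simulated, under a block representation function, by a system using that fixed rule set with a suitable initial configuration. -/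
open scoped Classical

/-- A (total) configuration of a 2D cellular automaton, with states encoded as naturals. -/
abbrev Config : Type := Pos → ℕ

/-- The four cardinal directions, as offsets. -/
def dirOffset : Fin 4 → Pos
  | 0 => (1, 0)
  | 1 => (-1, 0)
  | 2 => (0, 1)
  | 3 => (0, -1)

/-- A block-pairwise asynchronous cellular automaton: rules `(σ1, σ2, d, σ1', σ2')`
update a cell in state `σ1` and its cardinal neighbour in direction `d` in state `σ2`
simultaneously to `σ1'` and `σ2'`. -/
structure BPACA where
  states : Finset ℕ
  rules : Finset (ℕ × ℕ × Fin 4 × ℕ × ℕ)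
  init : Config
  init_states : ∀ p : Pos, init p ∈ states
  rules_states : ∀ r ∈ rules,
    r.1 ∈ states ∧ r.2.1 ∈ states ∧ r.2.2.2.1 ∈ states ∧ r.2.2.2.2 ∈ states

/-- One asynchronous rule application of a block-pairwise ACA. -/
def BPACA.StepR (Γ : BPACA) (C C' : Config) : Prop :=
  ∃ r ∈ Γ.rules, ∃ p : Pos,
    C p = r.1 ∧ C (p + dirOffset r.2.2.1) = r.2.1 ∧
    C' = Function.update (Function.update C p r.2.2.2.1)
          (p + dirOffset r.2.2.1) r.2.2.2.2

/-- Reachability by asynchronous updates. -/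
def BPACA.Reach (Γ : BPACA) : Config → Config → Prop :=
  Relation.ReflTransGen Γ.StepR

/-- The reachable configurations of a block-pairwise ACA. -/
def BPACA.Reachable (Γ : BPACA) (C : Config) : Prop := Γ.Reach Γ.init C

/-- A pairwise asynchronous cellular automaton: rules `(σ1, σ2, d, σ1')` update only
the first cell of a pair consisting of a cell in state `σ1` and its cardinal
neighbour in direction `d` in state `σ2`. -/
structure PACA where
  states : Finset ℕ
  rules : Finset (ℕ × ℕ × Fin 4 × ℕ)
  init : Config
  init_states : ∀ p : Pos, init p ∈ states
  rules_states : ∀ r ∈ rules, r.1 ∈ states ∧ r.2.1 ∈ states ∧ r.2.2.2 ∈ states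

/-- One asynchronous rule application of a pairwise ACA. -/
def PACA.StepR (Γ : PACA) (C C' : Config) : Prop :=
  ∃ r ∈ Γ.rules, ∃ p : Pos,
    C p = r.1 ∧ C (p + dirOffset r.2.2.1) = r.2.1 ∧
    C' = Function.update C p r.2.2.2

/-- Reachability by asynchronous updates. -/
def PACA.Reach (Γ : PACA) : Config → Config → Prop :=
  Relation.ReflTransGen Γ.StepR

/-- The reachable configurations of a pairwise ACA. -/
def PACA.Reachable (Γ : PACA) (C : Config) : Prop := Γ.Reach Γ.init C

/-- An `m`-block of simulator states. -/
abbrev CBlock (m : ℕ) : Type := Fin m × Fin m → ℕ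

/-- The `m`-block of configuration `C` at block coordinates `(x, y)`. -/
def cblockAt (m : ℕ) (C : Config) (x y : ℤ) : CBlock m :=
  fun ij => C ((m : ℤ) * x + (ij.1.1 : ℤ), (m : ℤ) * y + (ij.2.1 : ℤ))

/-- `D = R*(C)`: `D` is the blockwise image of the configuration `C` under the
`m`-block representation function `R`. -/
def CRepMap (m : ℕ) (R : CBlock m → ℕ) (C D : Config) : Prop :=
  ∀ x y : ℤ, D (x, y) = R (cblockAt m C x y)

/-- Non-committal simulation of a block-pairwise ACA `ΓT` by a block-pairwise ACA `ΓS`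
under the `m`-block representation function `R`: equivalent productions, follows,
and non-committally models. -/
def BPACASimulates (m : ℕ) (R : CBlock m → ℕ) (ΓS ΓT : BPACA) : Prop :=
  0 < m ∧
  (∀ C', ΓS.Reachable C' → ∃ C, ΓT.Reachable C ∧ CRepMap m R C' C) ∧
  (∀ C, ΓT.Reachable C → ∃ C', ΓS.Reachable C' ∧ CRepMap m R C' C) ∧
  (∀ C' D', ΓS.Reachable C' → ΓS.Reach C' D' →
    ∀ C D, CRepMap m R C' C → CRepMap m R D' D → ΓT.Reach C D) ∧
  (∀ C D, ΓT.Reachable C → ΓT.Reach C D →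
    ∀ C', ΓS.Reachable C' → CRepMap m R C' C →
      ∃ D', ΓS.Reach C' D' ∧ CRepMap m R D' D)

/-- Non-committal simulation of a pairwise ACA `ΓT` by a pairwise ACA `ΓS`. -/
def PACASimulates (m : ℕ) (R : CBlock m → ℕ) (ΓS ΓT : PACA) : Prop :=
  0 < m ∧
  (∀ C', ΓS.Reachable C' → ∃ C, ΓT.Reachable C ∧ CRepMap m R C' C) ∧
  (∀ C, ΓT.Reachable C → ∃ C', ΓS.Reachable C' ∧ CRepMap m R C' C) ∧
  (∀ C' D', ΓS.Reachable C' → ΓS.Reach C' D' →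
    ∀ C D, CRepMap m R C' C → CRepMap m R D' D → ΓT.Reach C D) ∧
  (∀ C D, ΓT.Reachable C → ΓT.Reach C D →
    ∀ C', ΓS.Reachable C' → CRepMap m R C' C →
      ∃ D', ΓS.Reach C' D' ∧ CRepMap m R D' D)

namespace IU

abbrev Lane : Type := Bool × Fin 4

inductive Content
  | E : Content
  | T : Lane → Content
  | P : Lane → Fin 4 → Content
  | R : Lane → Fin 4 → Content

instance : Finite Content := by
  let f : Fin 4 × Lane × Fin 4 → Content := fun x =>
    if x.1 = 0 then .E else if x.1 = 1 then .T x.2.1 else if x.1 = 2 then .P x.2.1 x.2.2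
      else .R x.2.1 x.2.2
  refine Finite.of_surjective f ?_
  rintro (_ | l | ⟨l, d⟩ | ⟨l, d⟩)
  · exact ⟨(0, (true, 0), 0), by simp [f]⟩
  · exact ⟨(1, l, 0), by simp [f]⟩
  · exact ⟨(2, l, d), by simp [f]⟩
  · exact ⟨(3, l, d), by simp [f]⟩

def Content.lane : Content → Option Lane
  | .E => none
  | .T l => some l
  | .P l _ => some l
  | .R l _ => some l

/-- static cell program: junctions, permitted moves, permitted firings -/
abbrev Static : Type :=
  (Lane → Lane → Prop) × (Lane → Fin 4 → Prop) × (Lane → Lane → Lane → Fin 4 → Prop)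

abbrev CState : Type := Static × Content

instance finite_static : Finite Static := by
  haveI h1 : Finite (Lane → Lane → Prop) := inferInstance
  haveI h2 : Finite (Lane → Fin 4 → Prop) := inferInstance
  haveI h3 : Finite (Lane → Lane → Lane → Fin 4 → Prop) := inferInstance
  haveI h4 := @Finite.instProd _ _ h2 h3
  exact @Finite.instProd _ _ h1 h4

instance finite_cstate : Finite CState := @Finite.instProd _ _ finite_static inferInstance

def opp : Fin 4 → Fin 4
  | 0 => 1
  | 1 => 0
  | 2 => 3
  | 3 => 2

theorem opp_opp (d : Fin 4) : opp (opp d) = d := by fin_cases d <;> rfl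

theorem off_opp (d : Fin 4) : dirOffset (opp d) = - dirOffset d := by
  fin_cases d <;> simp [opp, dirOffset]

theorem off_ne (d : Fin 4) : dirOffset d ≠ 0 := by
  fin_cases d <;> simp [dirOffset]

theorem off_cancel (p : Pos) (d : Fin 4) : p + dirOffset d + dirOffset (opp d) = p := by
  rw [off_opp]; simp

theorem off_cancel2 (p : Pos) (d : Fin 4) : p + dirOffset (opp d) + dirOffset d = p := by
  rw [off_opp]; simp

theorem add_off_ne (p : Pos) (d : Fin 4) : p + dirOffset d ≠ p := by
  simpa using off_ne d

inductive CR (s : Static) : Content → Content → Fin 4 → Content → Prop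
  | offer (l : Lane) (d : Fin 4) (c : Content) : s.2.1 l d → CR s (.T l) c d (.P l d)
  | recv (l : Lane) (d : Fin 4) : CR s .E (.P l (opp d)) d (.R l d)
  | clear (l : Lane) (d : Fin 4) : CR s (.P l d) (.R l (opp d)) d .E
  | settle (l : Lane) (d : Fin 4) : CR s (.R l d) .E d (.T l)
  | junc (l l' : Lane) (d : Fin 4) (c : Content) : s.1 l l' → CR s (.T l) c d (.T l')
  | fire (l l2 l' : Lane) (d : Fin 4) : s.2.2 l l2 l' d → CR s (.T l) (.T l2) d (.T l')

noncomputable def enc : CState → ℕ := (exists_injective_nat CState).choose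

theorem enc_inj : Function.Injective enc := (exists_injective_nat CState).choose_spec

noncomputable def StU : Finset ℕ := (@Set.finite_range _ _ enc finite_cstate).toFinset

def ruleSet : Set (ℕ × ℕ × Fin 4 × ℕ) :=
  {r | ∃ (s s2 : Static) (c c2 : Content) (d : Fin 4) (c' : Content),
    CR s c c2 d c' ∧ r = (enc (s, c), enc (s2, c2), d, enc (s, c'))}

theorem ruleSet_finite : ruleSet.Finite := by
  let f : CState × CState × Fin 4 × CState → ℕ × ℕ × Fin 4 × ℕ :=
    fun x => (enc x.1, enc x.2.1, x.2.2.1, enc x.2.2.2)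
  haveI h1 : Finite (Fin 4 × CState) := @Finite.instProd _ _ inferInstance finite_cstate
  haveI h2 := @Finite.instProd _ _ finite_cstate h1
  haveI h3 := @Finite.instProd _ _ finite_cstate h2
  refine (@Set.finite_range _ _ f h3).subset ?_
  rintro r ⟨s, s2, c, c2, d, c', _, rfl⟩
  exact ⟨((s, c), (s2, c2), d, (s, c')), rfl⟩

noncomputable def rulesU : Finset (ℕ × ℕ × Fin 4 × ℕ) := ruleSet_finite.toFinset

inductive Tok
  | t : Pos → Lane → Tok
  | p : Pos → Lane → Fin 4 → Tok
  | pr : Pos → Lane → Fin 4 → Tok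
  | r : Pos → Lane → Fin 4 → Tok

noncomputable def render : Tok → Pos → Content
  | .t u l, q => if q = u then .T l else .E
  | .p u l d, q => if q = u then .P l d else .E
  | .pr u l d, q => if q = u then .P l d else
      if q = u + dirOffset d then .R l (opp d) else .E
  | .r u l d, q => if q = u + dirOffset d then .R l (opp d) else .E

def blk (m : ℕ) (p : Pos) : Pos := (p.1 / (m : ℤ), p.2 / (m : ℤ))

def Lab (m : ℕ) (t : ℤ → Fin 4 → ℕ) (p : Pos) (l : Lane) : ℕ :=
  if l.1 then t (p.1 % (m : ℤ)) l.2 else t (p.2 % (m : ℤ)) l.2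

def stat (m : ℕ) (t : ℤ → Fin 4 → ℕ) (rules : Finset (ℕ × ℕ × Fin 4 × ℕ)) (p : Pos) : Static :=
  (fun l l' => Lab m t p l = Lab m t p l',
   fun l d => blk m (p + dirOffset d) = blk m p ∧ Lab m t (p + dirOffset d) l = Lab m t p l,
   fun l l2 l' d => blk m (p + dirOffset d) = blk m p + dirOffset d ∧
     (Lab m t p l, Lab m t (p + dirOffset d) l2, d, Lab m t p l') ∈ rules)

def Good (m : ℕ) (t : ℤ → Fin 4 → ℕ) (b : Pos) : Tok → Prop
  | .t u _ => blk m u = b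
  | .p u l d => blk m u = b ∧ blk m (u + dirOffset d) = b ∧
      Lab m t (u + dirOffset d) l = Lab m t u l
  | .pr u l d => blk m u = b ∧ blk m (u + dirOffset d) = b ∧
      Lab m t (u + dirOffset d) l = Lab m t u l
  | .r u l d => blk m u = b ∧ blk m (u + dirOffset d) = b ∧
      Lab m t (u + dirOffset d) l = Lab m t u l

def label (m : ℕ) (t : ℤ → Fin 4 → ℕ) : Tok → ℕ
  | .t u l => Lab m t u l
  | .p u l _ => Lab m t u l
  | .pr u l _ => Lab m t u l
  | .r u l _ => Lab m t u l

noncomputable def encC (m : ℕ) (t : ℤ → Fin 4 → ℕ) (rules : Finset (ℕ × ℕ × Fin 4 × ℕ))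
    (Q : Pos → Tok) : Config :=
  fun p => enc (stat m t rules p, render (Q (blk m p)) p)

def labC (m : ℕ) (t : ℤ → Fin 4 → ℕ) (Q : Pos → Tok) : Config := fun b => label m t (Q b)

def Valid (m : ℕ) (t : ℤ → Fin 4 → ℕ) (Q : Pos → Tok) : Prop := ∀ b, Good m t b (Q b)

section
variable {m : ℕ} {t : ℤ → Fin 4 → ℕ} {rules : Finset (ℕ × ℕ × Fin 4 × ℕ)}

theorem encC_update (Q : Pos → Tok) (b p : Pos) (q' : Tok) (c' : Content) (hp : blk m p = b)
    (h : ∀ p', blk m p' = b → render q' p' = if p' = p then c' else render (Q b) p') :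
    encC m t rules (Function.update Q b q') =
      Function.update (encC m t rules Q) p (enc (stat m t rules p, c')) := by
  funext p'
  by_cases h1 : p' = p
  · subst h1
    simp [encC, hp, h p' hp]
  · by_cases h2 : blk m p' = b
    · simp [encC, h1, h2, h p' h2]
    · simp [encC, h1, h2]

theorem valid_update {Q : Pos → Tok} (hQ : Valid m t Q) {b : Pos} {q' : Tok}
    (h : Good m t b q') : Valid m t (Function.update Q b q') := by
  intro b'
  by_cases hb : b' = b
  · subst hb; simpa using h
  · simpa [hb] using hQ b'

theorem labC_update (Q : Pos → Tok) (b : Pos) (q' : Tok) :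
    labC m t (Function.update Q b q') = Function.update (labC m t Q) b (label m t q') := by
  funext b'
  by_cases hb : b' = b
  · subst hb; simp [labC]
  · simp [labC, hb]

theorem labC_update_same (Q : Pos → Tok) (b : Pos) (q' : Tok)
    (h : label m t q' = label m t (Q b)) :
    labC m t (Function.update Q b q') = labC m t Q := by
  rw [labC_update, h]
  exact Function.update_eq_self b (labC m t Q)

/-- abstract step -/
def AStep (m : ℕ) (t : ℤ → Fin 4 → ℕ) (rules : Finset (ℕ × ℕ × Fin 4 × ℕ))
    (C C' : Config) : Prop :=
  ∃ r ∈ rulesU, ∃ p : Pos,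
    C p = r.1 ∧ C (p + dirOffset r.2.2.1) = r.2.1 ∧ C' = Function.update C p r.2.2.2

theorem render_T {q : Tok} {p : Pos} {l : Lane} (h : render q p = .T l) : q = .t p l := by
  cases q <;> simp only [render] at h <;> split_ifs at h <;> simp_all

theorem render_P {q : Tok} {p : Pos} {l : Lane} {d : Fin 4} (h : render q p = .P l d) :
    q = .p p l d ∨ q = .pr p l d := by
  cases q <;> simp only [render] at h <;> split_ifs at h <;> simp_all

theorem render_R {q : Tok} {p : Pos} {l : Lane} {d : Fin 4} (h : render q p = .R l d) :
    q = .pr (p + dirOffset d) l (opp d) ∨ q = .r (p + dirOffset d) l (opp d) := by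
  cases q <;> simp only [render] at h <;> split_ifs at h <;>
    simp only [Content.R.injEq, reduceCtorEq] at h
  · obtain ⟨rfl, rfl⟩ := h
    left; simp_all [off_cancel, opp_opp]
  · obtain ⟨rfl, rfl⟩ := h
    right; simp_all [off_cancel, opp_opp]

theorem step_forward (Q : Pos → Tok) (hQ : Valid m t Q) (C' : Config)
    (hs : AStep m t rules (encC m t rules Q) C') :
    ∃ b q', Good m t b q' ∧ C' = encC m t rules (Function.update Q b q') ∧
      (label m t q' = label m t (Q b) ∨
        ∃ d, (label m t (Q b), label m t (Q (b + dirOffset d)), d, label m t q') ∈ rules) := by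
  obtain ⟨r, hr, p, h1, h2, rfl⟩ := hs
  simp only [rulesU, Set.Finite.mem_toFinset] at hr
  obtain ⟨s, s2, c, c2, d, c', hc, rfl⟩ := hr
  simp only at h1 h2 ⊢
  have h1 := enc_inj h1
  have h2 := enc_inj h2
  simp only [Prod.mk.injEq] at h1 h2
  obtain ⟨rfl, hc1⟩ := h1
  obtain ⟨-, hc2⟩ := h2
  cases hc with
  | offer l d c hA =>
    have hq := render_T hc1
    refine ⟨blk m p, .p p l d, ⟨rfl, hA.1, hA.2⟩, ?_, ?_⟩
    · refine (encC_update Q _ p _ _ rfl ?_).symm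
      intro p' _
      rw [hq]; simp only [render]; split_ifs <;> rfl
    · left; rw [hq]; rfl
  | recv l d =>
    rcases render_P hc2 with hq | hq
    · have hg := hQ (blk m (p + dirOffset d))
      rw [hq] at hg
      obtain ⟨-, hb, hl⟩ := hg
      rw [off_cancel] at hb hl
      rw [← hb] at hq
      refine ⟨blk m p, .pr (p + dirOffset d) l (opp d), ⟨hb.symm, ?_, ?_⟩, ?_, ?_⟩
      · rw [off_cancel]
      · rw [off_cancel, hl]
      · refine (encC_update Q _ p _ _ rfl ?_).symm
        intro p' _
        rw [hq]; simp only [render, off_cancel, opp_opp]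
        have := add_off_ne p d
        split_ifs <;> simp_all
      · left; rw [hq]; rfl
    · exfalso
      have hg := hQ (blk m (p + dirOffset d))
      rw [hq] at hg
      obtain ⟨-, hb, hl⟩ := hg
      rw [off_cancel] at hb
      rw [← hb] at hq
      rw [hq] at hc1
      have := add_off_ne p d
      simp only [render, off_cancel] at hc1
      simp [this.symm] at hc1
  | clear l d =>
    rcases render_P hc1 with hq | hq
    · exfalso
      have hg := hQ (blk m p)
      rw [hq] at hg
      obtain ⟨-, hb, hl⟩ := hg
      rw [hb, hq] at hc2
      simp only [render] at hc2
      rw [if_neg (add_off_ne p d)] at hc2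
      cases hc2
    · have hg := hQ (blk m p)
      rw [hq] at hg
      refine ⟨blk m p, .r p l d, hg, ?_, ?_⟩
      · refine (encC_update Q _ p _ _ rfl ?_).symm
        intro p' _
        rw [hq]; simp only [render]
        have := add_off_ne p d
        split_ifs <;> simp_all
      · left; rw [hq]; rfl
  | settle l d =>
    rcases render_R hc1 with hq | hq
    · exfalso
      have hg := hQ (blk m p)
      rw [hq] at hg
      obtain ⟨hb, -, hl⟩ := hg
      rw [hb, hq] at hc2
      simp [render] at hc2
    · have hg := hQ (blk m p)
      rw [hq] at hg
      obtain ⟨hb, -, hl⟩ := hg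
      rw [off_cancel] at hl
      refine ⟨blk m p, .t p l, rfl, ?_, ?_⟩
      · refine (encC_update Q _ p _ _ rfl ?_).symm
        intro p' _
        rw [hq]; simp only [render, off_cancel]
        split_ifs <;> simp_all
      · left; rw [hq]; exact hl
  | junc l l' d c hJ =>
    have hq := render_T hc1
    refine ⟨blk m p, .t p l', rfl, ?_, ?_⟩
    · refine (encC_update Q _ p _ _ rfl ?_).symm
      intro p' _
      rw [hq]; simp only [render]; split_ifs <;> rfl
    · left; rw [hq]; exact hJ.symm
  | fire l l2 l' d hF =>
    have hq := render_T hc1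
    have hq2 := render_T hc2
    refine ⟨blk m p, .t p l', rfl, ?_, ?_⟩
    · refine (encC_update Q _ p _ _ rfl ?_).symm
      intro p' _
      rw [hq]; simp only [render]; split_ifs <;> rfl
    · right
      refine ⟨d, ?_⟩
      rw [← hF.1, hq, hq2]; exact hF.2

/-- a basic concrete step -/
theorem step_back (Q : Pos → Tok) (p : Pos) (d : Fin 4) (c2 c' : Content) (q' : Tok)
    (h2 : render (Q (blk m (p + dirOffset d))) (p + dirOffset d) = c2)
    (hc : CR (stat m t rules p) (render (Q (blk m p)) p) c2 d c')
    (h : ∀ p', blk m p' = blk m p →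
      render q' p' = if p' = p then c' else render (Q (blk m p)) p') :
    AStep m t rules (encC m t rules Q) (encC m t rules (Function.update Q (blk m p) q')) := by
  rw [encC_update Q (blk m p) p q' c' rfl h]
  refine ⟨(enc (stat m t rules p, render (Q (blk m p)) p),
    enc (stat m t rules (p + dirOffset d), c2), d, enc (stat m t rules p, c')), ?_, p, rfl, ?_, rfl⟩
  · simp only [rulesU, Set.Finite.mem_toFinset]
    exact ⟨_, _, _, _, _, _, hc, rfl⟩
  · simp only [encC, h2]

abbrev AReach (m : ℕ) (t : ℤ → Fin 4 → ℕ) (rules : Finset (ℕ × ℕ × Fin 4 × ℕ)) :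
    Config → Config → Prop := Relation.ReflTransGen (AStep m t rules)

/-- token in block `b` can go from `q` to `q'` whatever the rest does -/
def Go (m : ℕ) (t : ℤ → Fin 4 → ℕ) (rules : Finset (ℕ × ℕ × Fin 4 × ℕ)) (b : Pos) (q q' : Tok) :
    Prop :=
  ∀ Q : Pos → Tok, Q b = q →
    AReach m t rules (encC m t rules Q) (encC m t rules (Function.update Q b q'))

theorem Go.refl (b : Pos) (q : Tok) : Go m t rules b q q := by
  intro Q h
  rw [← h, Function.update_eq_self]

theorem Go.trans {b : Pos} {q q' q'' : Tok} (h : Go m t rules b q q')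
    (h' : Go m t rules b q' q'') : Go m t rules b q q'' := by
  intro Q hQ
  have h1 := h Q hQ
  have h2 := h' (Function.update Q b q') (by simp)
  rw [Function.update_idem] at h2
  exact h1.trans h2

theorem go_r {b u : Pos} {l : Lane} {d : Fin 4} (h : Good m t b (.r u l d)) :
    Go m t rules b (.r u l d) (.t (u + dirOffset d) l) := by
  obtain ⟨h1, h2, h3⟩ := h
  intro Q hQ
  subst h2
  refine .single (step_back Q _ (opp d) .E (.T l) _ ?_ ?_ ?_)
  · rw [off_cancel, h1, hQ]
    simp only [render]; rw [if_neg (add_off_ne u d).symm]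
  · rw [hQ]; simp only [render, if_true]; exact .settle _ _
  · intro p' _
    rw [hQ]; simp only [render]; split_ifs <;> rfl

theorem go_pr {b u : Pos} {l : Lane} {d : Fin 4} (h : Good m t b (.pr u l d)) :
    Go m t rules b (.pr u l d) (.t (u + dirOffset d) l) := by
  refine Go.trans ?_ (go_r h)
  obtain ⟨h1, h2, h3⟩ := h
  intro Q hQ
  subst h1
  refine .single (step_back Q _ d (.R l (opp d)) .E _ ?_ ?_ ?_)
  · rw [h2, hQ]
    simp only [render]; rw [if_neg (add_off_ne u d)]; simp
  · rw [hQ]; simp only [render, if_true]; exact .clear _ _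
  · intro p' _
    have := add_off_ne u d
    rw [hQ]; simp only [render]; split_ifs <;> simp_all

theorem go_p {b u : Pos} {l : Lane} {d : Fin 4} (h : Good m t b (.p u l d)) :
    Go m t rules b (.p u l d) (.t (u + dirOffset d) l) := by
  refine Go.trans ?_ (go_pr h)
  obtain ⟨h1, h2, h3⟩ := h
  intro Q hQ
  subst h2
  refine .single (step_back Q _ (opp d) (.P l d) (.R l (opp d)) _ ?_ ?_ ?_)
  · rw [off_cancel, h1, hQ]
    simp only [render, if_true]
  · rw [hQ]; simp only [render]; rw [if_neg (add_off_ne u d)]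
    have := CR.recv (s := stat m t rules (u + dirOffset d)) l (opp d)
    rwa [opp_opp] at this
  · intro p' _
    have := add_off_ne u d
    rw [hQ]; simp only [render]; split_ifs <;> simp_all

theorem go_move {b u : Pos} {l : Lane} {d : Fin 4} (h : Good m t b (.p u l d)) :
    Go m t rules b (.t u l) (.t (u + dirOffset d) l) := by
  refine Go.trans ?_ (go_p h)
  obtain ⟨h1, h2, h3⟩ := h
  intro Q hQ
  subst h1
  refine .single (step_back Q _ d _ (.P l d) _ rfl ?_ ?_)
  · rw [hQ]; simp only [render, if_true]
    exact .offer _ _ _ ⟨h2, h3⟩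
  · intro p' _
    rw [hQ]; simp only [render]; split_ifs <;> rfl

theorem go_junc {b u : Pos} {l l' : Lane} (h1 : blk m u = b)
    (h : Lab m t u l = Lab m t u l') :
    Go m t rules b (.t u l) (.t u l') := by
  intro Q hQ
  subst h1
  refine .single (step_back Q _ 0 _ (.T l') _ rfl ?_ ?_)
  · rw [hQ]; simp only [render, if_true]
    exact .junc _ _ _ _ h
  · intro p' _
    rw [hQ]; simp only [render]; split_ifs <;> rfl

theorem go_norm {b : Pos} {q : Tok} (h : Good m t b q) :
    ∃ u l, blk m u = b ∧ Lab m t u l = label m t q ∧ Go m t rules b q (.t u l) := by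
  cases q with
  | t u l => exact ⟨u, l, h, rfl, Go.refl _ _⟩
  | p u l d => exact ⟨_, l, h.2.1, h.2.2, go_p h⟩
  | pr u l d => exact ⟨_, l, h.2.1, h.2.2, go_pr h⟩
  | r u l d => exact ⟨_, l, h.2.1, h.2.2, go_r h⟩

theorem go_walk {b : Pos} {l : Lane} {d : Fin 4} {a : ℕ} (n : ℕ) (u : Pos)
    (h : ∀ i : ℕ, i ≤ n → blk m (u + i • dirOffset d) = b ∧ Lab m t (u + i • dirOffset d) l = a) :
    Go m t rules b (.t u l) (.t (u + n • dirOffset d) l) := by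
  induction n with
  | zero => simpa using Go.refl b (.t u l)
  | succ n ih =>
    refine Go.trans (ih (fun i hi => h i (by omega))) ?_
    have e : u + (n + 1) • dirOffset d = u + n • dirOffset d + dirOffset d := by
      rw [succ_nsmul, add_assoc]
    have h1 := h n (by omega)
    have h2 := h (n + 1) le_rfl
    rw [e] at h2 ⊢
    exact go_move ⟨h1.1, h2.1, h2.2.trans h1.2.symm⟩

/-- position with block `b` and inner coordinates `x y`. -/
def at' (m : ℕ) (b : Pos) (x y : ℤ) : Pos := ((m : ℤ) * b.1 + x, (m : ℤ) * b.2 + y)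

theorem div_aux {b x : ℤ} (h0 : 0 ≤ x) (h1 : x < m) : ((m : ℤ) * b + x) / m = b := by
  have hm : (m : ℤ) ≠ 0 := by omega
  rw [Int.mul_add_ediv_left _ _ hm, Int.ediv_eq_zero_of_lt h0 h1, add_zero]

theorem mod_aux {b x : ℤ} (h0 : 0 ≤ x) (h1 : x < m) : ((m : ℤ) * b + x) % m = x := by
  rw [Int.mul_add_emod_self_left, Int.emod_eq_of_lt h0 h1]

theorem blk_at {b : Pos} {x y : ℤ} (hx : 0 ≤ x) (hx' : x < m) (hy : 0 ≤ y) (hy' : y < m) :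
    blk m (at' m b x y) = b := by
  simp only [blk, at', div_aux hx hx', div_aux hy hy']

theorem lab_h {b : Pos} {x y : ℤ} (hy : 0 ≤ y) (hy' : y < m) (k : Fin 4) :
    Lab m t (at' m b x y) (false, k) = t y k := by
  simp [Lab, at', mod_aux hy hy']

theorem lab_v {b : Pos} {x y : ℤ} (hx : 0 ≤ x) (hx' : x < m) (k : Fin 4) :
    Lab m t (at' m b x y) (true, k) = t x k := by
  simp [Lab, at', mod_aux hx hx']

theorem exists_at (hm : 0 < m) {b u : Pos} (h : blk m u = b) :
    ∃ x y : ℤ, 0 ≤ x ∧ x < m ∧ 0 ≤ y ∧ y < m ∧ u = at' m b x y := by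
  have hm' : (0 : ℤ) < m := by exact_mod_cast hm
  refine ⟨u.1 % m, u.2 % m, Int.emod_nonneg _ hm'.ne', Int.emod_lt_of_pos _ hm',
    Int.emod_nonneg _ hm'.ne', Int.emod_lt_of_pos _ hm', ?_⟩
  subst h
  simp only [at', blk, Int.mul_ediv_add_emod]

theorem go_h {b : Pos} {x x' y : ℤ} (hx : 0 ≤ x) (hx' : x < m) (hz : 0 ≤ x') (hz' : x' < m)
    (hy : 0 ≤ y) (hy' : y < m) (k : Fin 4) :
    Go m t rules b (.t (at' m b x y) (false, k)) (.t (at' m b x' y) (false, k)) := by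
  rcases le_total x x' with hle | hle
  · obtain ⟨n, rfl⟩ : ∃ n : ℕ, x' = x + n := ⟨(x' - x).toNat, by omega⟩
    have key : ∀ i : ℕ, at' m b x y + i • dirOffset 0 = at' m b (x + i) y := by
      intro i; simp [at', dirOffset]; ring
    rw [← key]
    refine go_walk (a := t y k) n _ ?_
    intro i hi
    rw [key]
    exact ⟨blk_at (by omega) (by omega) hy hy', lab_h hy hy' k⟩
  · obtain ⟨n, rfl⟩ : ∃ n : ℕ, x' = x - n := ⟨(x - x').toNat, by omega⟩
    have key : ∀ i : ℕ, at' m b x y + i • dirOffset 1 = at' m b (x - i) y := by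
      intro i; simp [at', dirOffset]; ring
    rw [← key]
    refine go_walk (a := t y k) n _ ?_
    intro i hi
    rw [key]
    exact ⟨blk_at (by omega) (by omega) hy hy', lab_h hy hy' k⟩

theorem go_v {b : Pos} {x y y' : ℤ} (hx : 0 ≤ x) (hx' : x < m) (hz : 0 ≤ y') (hz' : y' < m)
    (hy : 0 ≤ y) (hy' : y < m) (k : Fin 4) :
    Go m t rules b (.t (at' m b x y) (true, k)) (.t (at' m b x y') (true, k)) := by
  rcases le_total y y' with hle | hle
  · obtain ⟨n, rfl⟩ : ∃ n : ℕ, y' = y + n := ⟨(y' - y).toNat, by omega⟩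
    have key : ∀ i : ℕ, at' m b x y + i • dirOffset 2 = at' m b x (y + i) := by
      intro i; simp [at', dirOffset]; ring
    rw [← key]
    refine go_walk (a := t x k) n _ ?_
    intro i hi
    rw [key]
    exact ⟨blk_at hx hx' (by omega) (by omega), lab_v hx hx' k⟩
  · obtain ⟨n, rfl⟩ : ∃ n : ℕ, y' = y - n := ⟨(y - y').toNat, by omega⟩
    have key : ∀ i : ℕ, at' m b x y + i • dirOffset 3 = at' m b x (y - i) := by
      intro i; simp [at', dirOffset]; ring
    rw [← key]
    refine go_walk (a := t x k) n _ ?_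
    intro i hi
    rw [key]
    exact ⟨blk_at hx hx' (by omega) (by omega), lab_v hx hx' k⟩

/-- All places with label `a` are connected, given a hub. -/
theorem go_all (hm : 0 < m) {b u v : Pos} {l l' : Lane} {a : ℕ}
    (hub : ∃ x : ℤ, 0 ≤ x ∧ x < m ∧ t x 0 = a)
    (hu : blk m u = b) (hv : blk m v = b) (hul : Lab m t u l = a) (hvl : Lab m t v l' = a) :
    Go m t rules b (.t u l) (.t v l') := by
  obtain ⟨z, hz, hz', hza⟩ := hub
  have diag : ∀ k k' : Bool, Go m t rules b (.t (at' m b z z) (k, 0)) (.t (at' m b z z) (k', 0)) := by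
    intro k k'
    refine go_junc (blk_at hz hz' hz hz') ?_
    cases k <;> cases k' <;> simp only [lab_h hz hz', lab_v hz hz']
  have hto : Go m t rules b (.t u l) (.t (at' m b z z) (true, 0)) := by
    obtain ⟨x, y, hx, hx', hy, hy', rfl⟩ := exists_at hm hu
    obtain ⟨k, i⟩ := l
    cases k
    · rw [lab_h hy hy'] at hul
      refine (go_h hx hx' hz hz' hy hy' i).trans (Go.trans (go_junc (l' := (true, 0))
        (blk_at hz hz' hy hy') ?_) (go_v hz hz' hz hz' hy hy' 0))
      rw [lab_h hy hy', lab_v hz hz', hul, hza]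
    · rw [lab_v hx hx'] at hul
      refine (go_v hx hx' hz hz' hy hy' i).trans (Go.trans (go_junc (l' := (false, 0))
        (blk_at hx hx' hz hz') ?_) ((go_h hx hx' hz hz' hz hz' 0).trans (diag _ _)))
      rw [lab_h hz hz', lab_v hx hx', hul, hza]
  have fro : Go m t rules b (.t (at' m b z z) (true, 0)) (.t v l') := by
    obtain ⟨x, y, hx, hx', hy, hy', rfl⟩ := exists_at hm hv
    obtain ⟨k, i⟩ := l'
    cases k
    · rw [lab_h hy hy'] at hvl
      refine (go_v hz hz' hy hy' hz hz' 0).trans (Go.trans (go_junc (l' := (false, i))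
        (blk_at hz hz' hy hy') ?_) (go_h hz hz' hx hx' hy hy' i))
      rw [lab_h hy hy', lab_v hz hz', hvl, hza]
    · rw [lab_v hx hx'] at hvl
      refine (diag _ false).trans ((go_h hz hz' hx hx' hz hz' 0).trans
        (Go.trans (go_junc (l' := (true, i))
        (blk_at hx hx' hz hz') ?_) (go_v hx hx' hy hy' hz hz' i)))
      rw [lab_h hz hz', lab_v hx hx', hvl, hza]
  exact hto.trans fro

/-- contact position for rule `j` in direction `d` -/
theorem contact (hm : 0 < m) (b : Pos) (d : Fin 4) (j : ℤ) (hj : 0 ≤ j) (hj' : j < m) :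
    ∃ (u : Pos) (s : Bool), blk m u = b ∧ blk m (u + dirOffset d) = b + dirOffset d ∧
      ∀ k, Lab m t u (s, k) = t j k ∧ Lab m t (u + dirOffset d) (s, k) = t j k := by
  have h0 : (0 : ℤ) ≤ 0 := le_rfl
  have hm0 : (0 : ℤ) < m := by omega
  have hm1 : (0 : ℤ) ≤ (m : ℤ) - 1 := by omega
  have hm2 : (m : ℤ) - 1 < m := by omega
  fin_cases d
  · have e : at' m b (m - 1) j + dirOffset 0 = at' m (b + dirOffset 0) 0 j := by
      simp [at', dirOffset]; ring
    refine ⟨at' m b (m - 1) j, false, blk_at hm1 hm2 hj hj', ?_, fun k => ⟨lab_h hj hj' k, ?_⟩⟩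
    · exact e ▸ blk_at h0 hm0 hj hj'
    · exact e ▸ lab_h hj hj' k
  · have e : at' m b 0 j + dirOffset 1 = at' m (b + dirOffset 1) (m - 1) j := by
      simp [at', dirOffset]; ring
    refine ⟨at' m b 0 j, false, blk_at h0 hm0 hj hj', ?_, fun k => ⟨lab_h hj hj' k, ?_⟩⟩
    · exact e ▸ blk_at hm1 hm2 hj hj'
    · exact e ▸ lab_h hj hj' k
  · have e : at' m b j (m - 1) + dirOffset 2 = at' m (b + dirOffset 2) j 0 := by
      simp [at', dirOffset]; ring
    refine ⟨at' m b j (m - 1), true, blk_at hj hj' hm1 hm2, ?_, fun k => ⟨lab_v hj hj' k, ?_⟩⟩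
    · exact e ▸ blk_at hj hj' h0 hm0
    · exact e ▸ lab_v hj hj' k
  · have e : at' m b j 0 + dirOffset 3 = at' m (b + dirOffset 3) j (m - 1) := by
      simp [at', dirOffset]; ring
    refine ⟨at' m b j 0, true, blk_at hj hj' h0 hm0, ?_, fun k => ⟨lab_v hj hj' k, ?_⟩⟩
    · exact e ▸ blk_at hj hj' hm1 hm2
    · exact e ▸ lab_v hj hj' k

theorem go_any (hm : 0 < m) {b v : Pos} {q : Tok} {l' : Lane}
    (hub : ∃ x : ℤ, 0 ≤ x ∧ x < m ∧ t x 0 = label m t q)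
    (hq : Good m t b q) (hv : blk m v = b) (hvl : Lab m t v l' = label m t q) :
    Go m t rules b q (.t v l') := by
  obtain ⟨u, l, hu, hl, hg⟩ := go_norm (rules := rules) hq
  exact hg.trans (go_all hm hub hu hv hl hvl)

/-- Simulating one step of the target. -/
theorem sim_step (hm : 0 < m) (Q : Pos → Tok) (hQ : Valid m t Q) (b : Pos)
    (r : ℕ × ℕ × Fin 4 × ℕ) (hr : r ∈ rules)
    (hub1 : ∃ x : ℤ, 0 ≤ x ∧ x < m ∧ t x 0 = r.1)
    (hub2 : ∃ x : ℤ, 0 ≤ x ∧ x < m ∧ t x 0 = r.2.1)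
    (hj : ∃ j : ℤ, 0 ≤ j ∧ j < m ∧ t j 1 = r.1 ∧ t j 2 = r.2.1 ∧ t j 3 = r.2.2.2)
    (h1 : labC m t Q b = r.1) (h2 : labC m t Q (b + dirOffset r.2.2.1) = r.2.1) :
    ∃ Q', Valid m t Q' ∧ AReach m t rules (encC m t rules Q) (encC m t rules Q') ∧
      labC m t Q' = Function.update (labC m t Q) b r.2.2.2 := by
  obtain ⟨a, a2, d, a'⟩ := r
  simp only at *
  obtain ⟨j, hj0, hj1, ja, ja2, ja'⟩ := hj
  obtain ⟨u, s, hu, hu2, hl⟩ := contact (t := t) hm b d j hj0 hj1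
  have hne : b + dirOffset d ≠ b := add_off_ne b d
  have g1 : Go m t rules b (Q b) (.t u (s, 1)) := by
    refine go_any hm ?_ (hQ b) hu ?_
    · rw [show label m t (Q b) = a from h1]; exact hub1
    · rw [(hl 1).1, ja]; exact h1.symm
  have g2 : Go m t rules (b + dirOffset d) (Q (b + dirOffset d)) (.t (u + dirOffset d) (s, 2)) := by
    refine go_any hm ?_ (hQ _) hu2 ?_
    · rw [show label m t (Q (b + dirOffset d)) = a2 from h2]; exact hub2
    · rw [(hl 2).2, ja2]; exact h2.symm
  have r1 := g1 Q rfl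
  set Q1 := Function.update Q b (.t u (s, 1)) with hQ1
  have r2 := g2 Q1 (by simp [hQ1, hne])
  set Q2 := Function.update Q1 (b + dirOffset d) (.t (u + dirOffset d) (s, 2)) with hQ2
  have e1 : Q2 b = .t u (s, 1) := by simp [hQ2, hQ1, hne.symm]
  have e2 : Q2 (b + dirOffset d) = .t (u + dirOffset d) (s, 2) := by simp [hQ2]
  have v1 : Valid m t Q1 := valid_update hQ hu
  have v2 : Valid m t Q2 := valid_update v1 hu2
  have l1 : labC m t Q1 = labC m t Q := by
    refine labC_update_same _ _ _ ?_
    simp only [label]; rw [(hl 1).1, ja]; exact h1.symm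
  have l2 : labC m t Q2 = labC m t Q := by
    rw [← l1]
    refine labC_update_same _ _ _ ?_
    change _ = labC m t Q1 _
    rw [l1, h2]
    simp only [label]; rw [(hl 2).2, ja2]
  refine ⟨Function.update Q2 b (.t u (s, 3)), valid_update v2 hu, ?_, ?_⟩
  · refine (r1.trans r2).tail ?_
    subst hu
    refine step_back Q2 u d (.T (s, 2)) (.T (s, 3)) _ ?_ ?_ ?_
    · rw [hu2, e2]; simp [render]
    · rw [e1]; simp only [render, if_true]
      refine .fire _ _ _ _ ⟨hu2, ?_⟩
      rw [(hl 1).1, (hl 2).2, (hl 3).1, ja, ja2, ja']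
      exact hr
    · intro p' _
      rw [e1]; simp only [render]; split_ifs <;> rfl
  · rw [labC_update, l2]
    simp only [label]; rw [(hl 3).1, ja']

/-- the representation function -/
noncomputable def Rep (m : ℕ) (t : ℤ → Fin 4 → ℕ) (B : CBlock m) : ℕ :=
  if h : ∃ (a : ℕ) (ij : Fin m × Fin m) (l : Lane) (s : Static) (c : Content),
      B ij = enc (s, c) ∧ c.lane = some l ∧ a = Lab m t ((ij.1.1 : ℤ), (ij.2.1 : ℤ)) l
  then h.choose else 0

theorem render_lane {b : Pos} {q : Tok} (h : Good m t b q) {p : Pos} {l : Lane}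
    (hl : (render q p).lane = some l) : Lab m t p l = label m t q := by
  cases q <;> simp only [render] at hl <;> split_ifs at hl <;>
    simp only [Content.lane, Option.some.injEq, reduceCtorEq] at hl <;> subst_vars
  · rfl
  · rfl
  · rfl
  · exact h.2.2
  · exact h.2.2

theorem render_ex {b : Pos} {q : Tok} (h : Good m t b q) :
    ∃ p l, blk m p = b ∧ (render q p).lane = some l := by
  cases q with
  | t u l => exact ⟨u, l, h, by simp [render, Content.lane]⟩
  | p u l d => exact ⟨u, l, h.1, by simp [render, Content.lane]⟩
  | pr u l d => exact ⟨u, l, h.1, by simp [render, Content.lane]⟩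
  | r u l d => exact ⟨_, l, h.2.1, by simp [render, Content.lane]⟩

theorem lab_at (b : Pos) (x y : ℤ) (l : Lane) : Lab m t (at' m b x y) l = Lab m t (x, y) l := by
  simp [Lab, at']

theorem rep_spec (hm : 0 < m) (Q : Pos → Tok) (hQ : Valid m t Q) (x y : ℤ) :
    Rep m t (cblockAt m (encC m t rules Q) x y) = label m t (Q (x, y)) := by
  have hb : ∀ ij : Fin m × Fin m, blk m (at' m (x, y) ij.1.1 ij.2.1) = (x, y) := fun ij =>
    blk_at (by omega) (by have := ij.1.2; omega) (by omega) (by have := ij.2.2; omega)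
  have hB : ∀ ij, cblockAt m (encC m t rules Q) x y ij =
      enc (stat m t rules (at' m (x, y) ij.1.1 ij.2.1),
        render (Q (x, y)) (at' m (x, y) ij.1.1 ij.2.1)) := by
    intro ij
    have : cblockAt m (encC m t rules Q) x y ij =
      encC m t rules Q (at' m (x, y) ij.1.1 ij.2.1) := rfl
    rw [this, encC, hb]
  have hex : ∃ (a : ℕ) (ij : Fin m × Fin m) (l : Lane) (s : Static) (c : Content),
      cblockAt m (encC m t rules Q) x y ij = enc (s, c) ∧ c.lane = some l ∧
        a = Lab m t ((ij.1.1 : ℤ), (ij.2.1 : ℤ)) l := by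
    obtain ⟨p, l, hp, hl⟩ := render_ex (hQ (x, y))
    obtain ⟨i, j, hi, hi', hj, hj', rfl⟩ := exists_at hm hp
    lift i to ℕ using hi
    lift j to ℕ using hj
    exact ⟨_, (⟨i, by omega⟩, ⟨j, by omega⟩), l, _, _, hB _, hl, rfl⟩
  rw [Rep, dif_pos hex]
  obtain ⟨ij, l, s, c, h1, h2, h3⟩ := hex.choose_spec
  rw [h3]
  rw [hB] at h1
  have h1 := enc_inj h1
  simp only [Prod.mk.injEq] at h1
  rw [← h1.2] at h2
  rw [← render_lane (hQ (x, y)) h2, lab_at]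

theorem rep_iff (hm : 0 < m) (Q : Pos → Tok) (hQ : Valid m t Q) (D : Config) :
    CRepMap m (Rep m t) (encC m t rules Q) D ↔ D = labC m t Q := by
  constructor
  · intro h
    funext ⟨x, y⟩
    rw [h x y, rep_spec hm Q hQ]; rfl
  · rintro rfl x y
    rw [rep_spec hm Q hQ]; rfl

end

theorem exists_table (ΓT : PACA) : ∃ (m : ℕ) (t : ℤ → Fin 4 → ℕ), 0 < m ∧
    (∀ a ∈ ΓT.states, ∃ x : ℤ, 0 ≤ x ∧ x < m ∧ t x 0 = a) ∧
    (∀ r ∈ ΓT.rules, ∃ j : ℤ, 0 ≤ j ∧ j < m ∧ t j 1 = r.1 ∧ t j 2 = r.2.1 ∧ t j 3 = r.2.2.2) := by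
  let f : ℤ → ℕ := fun i => ΓT.states.toList.getD i.toNat 0
  let g : ℤ → ℕ × ℕ × Fin 4 × ℕ := fun i => ΓT.rules.toList.getD i.toNat (0, 0, 0, 0)
  refine ⟨ΓT.states.card + ΓT.rules.card + 1,
    fun i k => if k = 0 then f i else if k = 1 then (g i).1 else if k = 2 then (g i).2.1
      else (g i).2.2.2, by omega, ?_, ?_⟩
  · intro a ha
    obtain ⟨i, hi, rfl⟩ := List.getElem_of_mem (Finset.mem_toList.2 ha)
    refine ⟨i, by omega, ?_, ?_⟩
    · rw [Finset.length_toList] at hi; push_cast; omega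
    · simp [f, List.getElem?_eq_getElem hi]
  · intro r hr
    obtain ⟨i, hi, rfl⟩ := List.getElem_of_mem (Finset.mem_toList.2 hr)
    refine ⟨i, by omega, ?_, ?_⟩
    · rw [Finset.length_toList] at hi; push_cast; omega
    · have : g i = ΓT.rules.toList[i] := by simp [g, List.getElem?_eq_getElem hi]
      simp [this]

theorem main (ΓT : PACA) : ∃ ΓS : PACA, ΓS.states = StU ∧ ΓS.rules = rulesU ∧
    ∃ (m : ℕ) (R : CBlock m → ℕ), PACASimulates m R ΓS ΓT := by
  obtain ⟨m, t, hm, hst, hru⟩ := exists_table ΓT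
  choose! h hh0 hh1 hht using hst
  let Q0 : Pos → Tok := fun b => .t (at' m b (h (ΓT.init b)) (h (ΓT.init b))) (false, 0)
  have hQ0 : Valid m t Q0 := fun b => by
    have hs := ΓT.init_states b
    exact blk_at (hh0 _ hs) (hh1 _ hs) (hh0 _ hs) (hh1 _ hs)
  have hL0 : labC m t Q0 = ΓT.init := by
    funext b
    have hs := ΓT.init_states b
    simp only [labC, Q0, label]
    rw [lab_h (hh0 _ hs) (hh1 _ hs), hht _ hs]
  let ΓS : PACA :=
    { states := StU
      rules := rulesU
      init := encC m t ΓT.rules Q0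
      init_states := fun p => by simp [StU, encC]
      rules_states := fun r hr => by
        simp only [rulesU, Set.Finite.mem_toFinset] at hr
        obtain ⟨s, s2, c, c2, d, c', _, rfl⟩ := hr
        simp [StU] }
  have hSR : ∀ {C D}, ΓS.Reach C D ↔ AReach m t ΓT.rules C D := Iff.rfl
  have fwd : ∀ Q, Valid m t Q → ∀ D', ΓS.Reach (encC m t ΓT.rules Q) D' →
      ∃ Q', Valid m t Q' ∧ D' = encC m t ΓT.rules Q' ∧
        ΓT.Reach (labC m t Q) (labC m t Q') := by
    intro Q hQ D' hr
    induction hr with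
    | refl => exact ⟨Q, hQ, rfl, .refl⟩
    | tail _ hs ih =>
      obtain ⟨Q1, hQ1, rfl, hT⟩ := ih
      obtain ⟨b, q', hg, rfl, hl⟩ := step_forward (rules := ΓT.rules) Q1 hQ1 _ hs
      refine ⟨_, valid_update hQ1 hg, rfl, ?_⟩
      rcases hl with hl | ⟨d, hl⟩
      · rwa [labC_update_same _ _ _ hl]
      · refine hT.tail ⟨_, hl, b, rfl, rfl, ?_⟩
        rw [labC_update]
  have bwd : ∀ Q, Valid m t Q → ∀ D, ΓT.Reach (labC m t Q) D →
      ∃ Q', Valid m t Q' ∧ ΓS.Reach (encC m t ΓT.rules Q) (encC m t ΓT.rules Q') ∧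
        labC m t Q' = D := by
    intro Q hQ D hr
    induction hr with
    | refl => exact ⟨Q, hQ, .refl, rfl⟩
    | tail _ hs ih =>
      obtain ⟨Q1, hQ1, hS, rfl⟩ := ih
      obtain ⟨r, hr, b, h1, h2, rfl⟩ := hs
      have hrs := ΓT.rules_states r hr
      obtain ⟨Q2, hQ2, hS2, hl⟩ := sim_step hm Q1 hQ1 b r hr
        ⟨_, hh0 _ hrs.1, hh1 _ hrs.1, hht _ hrs.1⟩
        ⟨_, hh0 _ hrs.2.1, hh1 _ hrs.2.1, hht _ hrs.2.1⟩ (hru r hr) h1 h2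
      exact ⟨Q2, hQ2, hS.trans hS2, hl⟩
  refine ⟨ΓS, rfl, rfl, m, Rep m t, hm, ?_, ?_, ?_, ?_⟩
  · intro C' hC'
    obtain ⟨Q, hQ, rfl, hT⟩ := fwd Q0 hQ0 C' hC'
    rw [hL0] at hT
    exact ⟨_, hT, (rep_iff hm Q hQ _).2 rfl⟩
  · intro C hC
    obtain ⟨Q, hQ, hS, hT⟩ := bwd Q0 hQ0 C (by rw [hL0]; exact hC)
    exact ⟨_, hS, (rep_iff hm Q hQ _).2 hT.symm⟩
  · intro C' D' hC' hD' C D hC hD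
    obtain ⟨Q, hQ, rfl, -⟩ := fwd Q0 hQ0 C' hC'
    obtain ⟨Q', hQ', rfl, hT⟩ := fwd Q hQ D' hD'
    rw [rep_iff hm Q hQ] at hC
    rw [rep_iff hm Q' hQ'] at hD
    rw [hC, hD]; exact hT
  · intro C D _ hCD C' hC' hC
    obtain ⟨Q, hQ, rfl, -⟩ := fwd Q0 hQ0 C' hC'
    rw [rep_iff hm Q hQ] at hC
    subst hC
    obtain ⟨Q', hQ', hS, hT⟩ := bwd Q hQ D hCD
    exact ⟨_, hS, (rep_iff hm Q' hQ' _).2 hT.symm⟩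

end IU

/-- The pairwise ACA model (2D ACA with cardinal neighbourhood of
size 2 and radius 1, each rule updating a single cell from that cell and one cardinal
neighbour) is strongly (non-committally) intrinsically universal: there is a fixed
pairwise ACA rule set (of constant size) such that every pairwise ACA system is
non-committally simulated, under a block representation function, by a system using
that fixed rule set with a suitable initial configuration. -/
theorem pairwiseACAisIU :
    ∃ (StU : Finset ℕ) (rulesU : Finset (ℕ × ℕ × Fin 4 × ℕ)),
      ∀ ΓT : PACA,
        ∃ ΓS : PACA, ΓS.states = StU ∧ ΓS.rules = rulesU ∧
          ∃ (m : ℕ) (R : CBlock m → ℕ), PACASimulates m R ΓS ΓT := by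
  exact ⟨IU.StU, IU.rulesU, IU.main⟩
end
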